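/- arXiv:2603.03721 — 3 statements merged into one kernel-verified Lean document; each statement's English description precedes it below -/
import Mathlib

section
/- The group ℚ₊×/N(K×) is an elementary abelian 2-group equal to the internal direct product of its subgroups Γ_in and Γ_rs, and the classes of the primes inert in K form an F₂-basis of Γ_in. In particular, if a ∈ ℚ₊× is a square-free positive integer divisible by some prime inert in K, then a is not a norm from K×. -/
/-!
STATEMENT 4.  Let `K = ℚ(√-p)`.  The group `ℚ₊ˣ/N(Kˣ)` is an elementary abelian
2-group, it is the internal direct product of its subgroups `Γ_in` and `Γ_rs`, and the
classes of the primes inert in `K` form an `𝔽₂`-basis of `Γ_in` (i.e. they generate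
`Γ_in` — which holds by definition — and they are independent: no nonempty finite
product of classes of distinct inert primes is trivial).  In particular, if `a` is a
square-free positive integer divisible by some prime inert in `K`, then `a` is not a
norm from `Kˣ`.
-/

section Grp

variable (K : Type) [Field K] [Algebra ℚ K] [FiniteDimensional ℚ K]

/-- The subgroup `N(Kˣ) ∩ ℚ₊ˣ` of the group `ℚ₊ˣ` of positive rationals. -/
noncomputable def normSubgroup : Subgroup (Units.posSubgroup ℚ) :=
  (Subgroup.comap (Units.posSubgroup ℚ).subtype
    (MonoidHom.range (Units.map (Algebra.norm ℚ : K →* ℚ))))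

/-- The group `G = ℚ₊ˣ / N(Kˣ)`. -/
noncomputable def QmodN := (Units.posSubgroup ℚ) ⧸ normSubgroup K

noncomputable instance : CommGroup (QmodN K) := by
  unfold QmodN; infer_instance

/-- The class of a positive rational number in `ℚ₊ˣ/N(Kˣ)` (junk value `1` if `a ≤ 0`). -/
noncomputable def clsQ (a : ℚ) : QmodN K :=
  if h : 0 < a then QuotientGroup.mk ⟨Units.mk0 a h.ne', h⟩ else 1

/-- O_K -/
noncomputable abbrev OK := integralClosure ℤ K

/-- `ℓ` is inert in `K`: the ideal `ℓ·O_K` is prime. -/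
def IsInert (ℓ : ℕ) : Prop := (Ideal.span {(ℓ : OK K)}).IsPrime

/-- `ℓ` is ramified in `K`: `ℓ·O_K = P²` for a prime ideal `P`. -/
def IsRamified (ℓ : ℕ) : Prop :=
  ∃ P : Ideal (OK K), P.IsPrime ∧ Ideal.span {(ℓ : OK K)} = P ^ 2

/-- `ℓ` is split in `K`: `ℓ·O_K = P·Q` for distinct prime ideals `P ≠ Q`. -/
def IsSplit (ℓ : ℕ) : Prop :=
  ∃ P Q : Ideal (OK K), P.IsPrime ∧ Q.IsPrime ∧ P ≠ Q ∧
    Ideal.span {(ℓ : OK K)} = P * Q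

/-- `Γ_in`: the subgroup of `ℚ₊ˣ/N(Kˣ)` generated by the classes of inert primes. -/
noncomputable def GammaIn : Subgroup (QmodN K) :=
  Subgroup.closure {g | ∃ ℓ : ℕ, ℓ.Prime ∧ IsInert K ℓ ∧ g = clsQ K (ℓ : ℚ)}

/-- `Γ_rs`: the subgroup generated by the classes of split or ramified primes. -/
noncomputable def GammaRs : Subgroup (QmodN K) :=
  Subgroup.closure
    {g | ∃ ℓ : ℕ, ℓ.Prime ∧ (IsSplit K ℓ ∨ IsRamified K ℓ) ∧ g = clsQ K (ℓ : ℚ)}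

end Grp


section Arithmetic

variable (K : Type) [Field K] [Algebra ℚ K]

lemma isTorsionFree_int : Module.IsTorsionFree ℤ K :=
  have : CharZero K := algebraRat.charZero K
  inferInstance

lemma OK.natCast_ne_zero {n : ℕ} (hn : n ≠ 0) : (n : OK K) ≠ 0 := by
  have : CharZero K := algebraRat.charZero K
  intro h
  have h' := congrArg (algebraMap (OK K) K) h
  rw [map_natCast, map_zero] at h'
  exact hn (by exact_mod_cast h')

variable [FiniteDimensional ℚ K]

lemma OK.isDedekindDomain : IsDedekindDomain (OK K) :=
  integralClosure.isDedekindDomain ℤ ℚ K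

lemma OK.module_free : Module.Free ℤ (OK K) :=
  have := isTorsionFree_int K
  IsIntegralClosure.module_free ℤ ℚ K (OK K)

lemma OK.module_finite : Module.Finite ℤ (OK K) :=
  IsIntegralClosure.finite ℤ ℚ K (OK K)

lemma OK.finrank_eq : Module.finrank ℤ (OK K) = Module.finrank ℚ K :=
  have := isTorsionFree_int K
  IsIntegralClosure.rank ℤ ℚ K (OK K)

lemma OK.norm_coe (y : OK K) :
    Algebra.norm ℚ (y : K) = (Algebra.norm ℤ y : ℚ) := by
  have := OK.module_free K
  have := OK.module_finite K
  have := IsIntegralClosure.isLocalization ℤ ℚ K (OK K)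
  exact Algebra.norm_localization (R := ℤ) (Rₘ := ℚ) (S := OK K) (Sₘ := K) (nonZeroDivisors ℤ) y

variable {K}

lemma absNorm_span_natCast [IsDedekindDomain (OK K)] [Module.Free ℤ (OK K)]
    (hK2 : Module.finrank ℚ K = 2) (n : ℕ) :
    Ideal.absNorm (Ideal.span {(n : OK K)}) = n ^ 2 := by
  have := OK.module_finite K
  have h : (n : OK K) = algebraMap ℤ (OK K) n := by simp
  rw [Ideal.absNorm_span_singleton, h, Algebra.norm_algebraMap, OK.finrank_eq, hK2, Int.natAbs_pow,
    Int.natAbs_natCast]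

/-- A rational prime is inert, split or ramified in a quadratic field. -/
lemma isSplit_or_isRamified_of_not_isInert (hK2 : Module.finrank ℚ K = 2) {ℓ : ℕ}
    (hℓ : ℓ.Prime) (h : ¬ IsInert K ℓ) : IsSplit K ℓ ∨ IsRamified K ℓ := by
  have := OK.isDedekindDomain K
  have := OK.module_free K
  have hN := absNorm_span_natCast hK2 ℓ
  have htop : Ideal.span {(ℓ : OK K)} ≠ ⊤ := by
    intro ht
    rw [Ideal.absNorm_eq_one_iff.mpr ht] at hN
    exact hℓ.one_lt.ne' (by simpa using hN.symm)
  obtain ⟨P, hP, hle⟩ := Ideal.exists_le_maximal _ htop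
  obtain ⟨Q, hQ⟩ := Ideal.dvd_iff_le.mpr hle
  have hmul : Ideal.absNorm P * Ideal.absNorm Q = ℓ ^ 2 := by rw [← map_mul, ← hQ, hN]
  obtain ⟨k, hk, hPk⟩ := (Nat.dvd_prime_pow hℓ).mp (Dvd.intro _ hmul)
  have hQ' : Q.IsPrime := by
    interval_cases k
    · exact absurd (Ideal.absNorm_eq_one_iff.mp (by simpa using hPk)) hP.ne_top
    · apply Ideal.isPrime_of_irreducible_absNorm
      have : Ideal.absNorm Q = ℓ := by
        rw [hPk, pow_one, sq] at hmul
        exact Nat.eq_of_mul_eq_mul_left hℓ.pos hmul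
      rw [this]
      exact hℓ
    · refine absurd ?_ h
      have hQ1 : Ideal.absNorm Q = 1 := by
        rw [hPk] at hmul
        exact Nat.eq_of_mul_eq_mul_left (pow_pos hℓ.pos 2) (by rw [hmul, mul_one])
      rw [Ideal.absNorm_eq_one_iff.mp hQ1, Ideal.mul_top] at hQ
      rw [IsInert, hQ]
      exact hP.isPrime
  by_cases hPQ : P = Q
  · subst hPQ
    exact Or.inr ⟨P, hQ', by rw [hQ, sq]⟩
  · exact Or.inl ⟨P, Q, hP.isPrime, hQ', hPQ, hQ⟩

lemma not_isInert_of_eq_mul {ℓ : ℕ} (hℓ : ℓ.Prime) {P Q : Ideal (OK K)} (hP : P.IsPrime)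
    (hQ : Q.IsPrime) (h : Ideal.span {(ℓ : OK K)} = P * Q) : ¬ IsInert K ℓ := by
  have := OK.isDedekindDomain K
  intro hI
  have hne : Ideal.span {(ℓ : OK K)} ≠ ⊥ := by
    simpa using OK.natCast_ne_zero K hℓ.ne_zero
  rcases (Ideal.prime_of_isPrime hne hI).irreducible.isUnit_or_isUnit h with hu | hu
  · exact hP.ne_top (Ideal.isUnit_iff.mp hu)
  · exact hQ.ne_top (Ideal.isUnit_iff.mp hu)

lemma not_isInert_of_isSplit_or_isRamified {ℓ : ℕ} (hℓ : ℓ.Prime)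
    (h : IsSplit K ℓ ∨ IsRamified K ℓ) : ¬ IsInert K ℓ := by
  rcases h with ⟨P, Q, hP, hQ, -, h⟩ | ⟨P, hP, h⟩
  · exact not_isInert_of_eq_mul hℓ hP hQ h
  · exact not_isInert_of_eq_mul hℓ hP hP (by rw [h, sq])

lemma even_padicValNat_absNorm [IsDedekindDomain (OK K)] [Module.Free ℤ (OK K)]
    (hK2 : Module.finrank ℚ K = 2) {ℓ : ℕ} (hℓ : ℓ.Prime) (hI : IsInert K ℓ)
    (I : Ideal (OK K)) : Even (padicValNat ℓ (Ideal.absNorm I)) := by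
  have := Fact.mk hℓ
  have := OK.module_finite K
  have hne : Ideal.span {(ℓ : OK K)} ≠ ⊥ := by
    simpa using OK.natCast_ne_zero K hℓ.ne_zero
  induction hn : Ideal.absNorm I using Nat.strong_induction_on generalizing I with
  | _ n ih =>
    by_cases hd : ℓ ∣ n
    · rcases Nat.eq_zero_or_pos n with rfl | hpos
      · simp
      obtain ⟨P, hP, hunder, J, rfl⟩ := Ideal.exists_isMaximal_dvd_of_dvd_absNorm
        (Nat.prime_iff_prime_int.mp hℓ) I (by rw [hn]; exact_mod_cast hd)
      have hmem : (ℓ : OK K) ∈ P := by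
        have h : (ℓ : ℤ) ∈ Ideal.under ℤ P := by
          rw [hunder]; exact Ideal.mem_span_singleton_self _
        simpa [Ideal.under, Ideal.mem_comap] using h
      have hPℓ : P = Ideal.span {(ℓ : OK K)} :=
        ((hI.isMaximal hne).eq_of_le hP.ne_top (by simpa using hmem)).symm
      rw [map_mul, hPℓ, absNorm_span_natCast hK2] at hn
      have hJ : Ideal.absNorm J ≠ 0 := by
        rintro h
        simp [h] at hn
        omega
      have hlt : Ideal.absNorm J < n := by
        rw [← hn]
        exact lt_mul_left (Nat.pos_of_ne_zero hJ) (Nat.one_lt_pow two_ne_zero hℓ.one_lt)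
      rw [← hn, padicValNat.mul (pow_ne_zero 2 hℓ.ne_zero) hJ, padicValNat.prime_pow]
      exact even_two.add (ih _ hlt J rfl)
    · simp [padicValNat.eq_zero_of_not_dvd hd]

/-- The valuation of a norm at an inert prime is even. -/
lemma even_padicValRat_norm (hK2 : Module.finrank ℚ K = 2) {ℓ : ℕ} (hℓ : ℓ.Prime)
    (hI : IsInert K ℓ) {x : K} (hx : x ≠ 0) : Even (padicValRat ℓ (Algebra.norm ℚ x)) := by
  have := Fact.mk hℓ
  have := OK.isDedekindDomain K
  have := OK.module_free K
  have := OK.module_finite K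
  have := algebraRat.charZero K
  obtain ⟨⟨m, hm⟩, hy⟩ := IsIntegral.exists_multiple_integral_of_isLocalization
    (nonZeroDivisors ℤ) x (Algebra.IsIntegral.isIntegral (R := ℚ) x)
  have hm0 : (m : ℚ) ≠ 0 := by exact_mod_cast nonZeroDivisors.ne_zero hm
  let y : OK K := ⟨_, hy⟩
  have hyx : (y : K) = algebraMap ℚ K m * x := by
    simp [y, Submonoid.smul_def]
  have hnorm : Algebra.norm ℚ (y : K) = (m : ℚ) ^ 2 * Algebra.norm ℚ x := by
    rw [hyx, map_mul, Algebra.norm_algebraMap, hK2]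
  have hx' : Algebra.norm ℚ x ≠ 0 := Algebra.norm_ne_zero_iff.mpr hx
  have heven : Even (padicValRat ℓ (Algebra.norm ℚ (y : K))) := by
    rw [OK.norm_coe, padicValRat.of_int, padicValInt, ← Ideal.absNorm_span_singleton]
    exact_mod_cast even_padicValNat_absNorm hK2 hℓ hI _
  rw [hnorm, padicValRat.mul (pow_ne_zero 2 hm0) hx', padicValRat.pow] at heven
  exact (Int.even_add.mp heven).mp (by simp)

end Arithmetic

section NormClasses

variable {K : Type} [Field K] [Algebra ℚ K]

/-- A positive rational number as an element of `ℚ₊ˣ`. -/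
noncomputable def posUnit (a : ℚ) (ha : 0 < a) : Units.posSubgroup ℚ :=
  ⟨Units.mk0 a ha.ne', ha⟩

lemma clsQ_eq_mk {a : ℚ} (ha : 0 < a) :
    clsQ K a = (QuotientGroup.mk (posUnit a ha) : Units.posSubgroup ℚ ⧸ normSubgroup K) :=
  dif_pos ha

lemma clsQ_mul {a b : ℚ} (ha : 0 < a) (hb : 0 < b) :
    clsQ K (a * b) = clsQ K a * clsQ K b := by
  have h : posUnit (a * b) (mul_pos ha hb) = posUnit a ha * posUnit b hb := by
    ext; simp [posUnit]
  rw [clsQ_eq_mk ha, clsQ_eq_mk hb, clsQ_eq_mk (mul_pos ha hb), h]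
  rfl

lemma exists_clsQ_eq (g : QmodN K) : ∃ a : ℚ, 0 < a ∧ clsQ K a = g := by
  obtain ⟨⟨u, hu⟩, rfl⟩ := QuotientGroup.mk_surjective (s := normSubgroup K) g
  have hu' : (0 : ℚ) < u := hu
  refine ⟨u, hu', (clsQ_eq_mk hu').trans (congrArg _ ?_)⟩
  ext
  simp [posUnit]

lemma clsQ_eq_one_iff {a : ℚ} (ha : 0 < a) :
    clsQ K a = 1 ↔ ∃ x : K, x ≠ 0 ∧ a = Algebra.norm ℚ x := by
  rw [clsQ_eq_mk ha]
  refine (QuotientGroup.eq_one_iff (N := normSubgroup K) _).trans ?_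
  constructor
  · rintro ⟨x, hx⟩
    exact ⟨x, x.ne_zero, by simpa [posUnit] using (congrArg Units.val hx).symm⟩
  · rintro ⟨x, hx, h⟩
    exact ⟨Units.mk0 x hx, by ext; simp [h, posUnit]⟩

lemma clsQ_one : clsQ K 1 = 1 :=
  (clsQ_eq_one_iff one_pos).mpr ⟨1, one_ne_zero, by simp⟩

lemma clsQ_sq (hK2 : Module.finrank ℚ K = 2) {a : ℚ} (ha : 0 < a) : clsQ K (a ^ 2) = 1 := by
  refine (clsQ_eq_one_iff (pow_pos ha 2)).mpr ⟨algebraMap ℚ K a, ?_, ?_⟩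
  · exact (map_ne_zero _).mpr ha.ne'
  · rw [Algebra.norm_algebraMap, hK2]

lemma QmodN.mul_self (hK2 : Module.finrank ℚ K = 2) (g : QmodN K) : g * g = 1 := by
  obtain ⟨a, ha, rfl⟩ := exists_clsQ_eq g
  rw [← clsQ_mul ha ha, ← sq, clsQ_sq hK2 ha]

lemma clsQ_prod {S : Finset ℕ} (hS : ∀ n ∈ S, 0 < n) :
    ∏ n ∈ S, clsQ K (n : ℚ) = clsQ K ((∏ n ∈ S, n : ℕ) : ℚ) := by
  induction S using Finset.induction_on with
  | empty => simp [clsQ_one]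
  | insert n S hn ih =>
    have hS' : ∀ n ∈ S, 0 < n := fun m hm => hS m (Finset.mem_insert_of_mem hm)
    rw [Finset.prod_insert hn, Finset.prod_insert hn, ih hS', Nat.cast_mul, clsQ_mul]
    · exact_mod_cast hS n (Finset.mem_insert_self n S)
    · exact_mod_cast Finset.prod_pos hS'

/-- A class generated by primes satisfying `T` has a representative whose valuations at all other
primes are even. -/
lemma exists_clsQ_eq_of_mem_closure (T : ℕ → Prop) {g : QmodN K}
    (hg : g ∈ Subgroup.closure {g | ∃ ℓ : ℕ, ℓ.Prime ∧ T ℓ ∧ g = clsQ K (ℓ : ℚ)}) :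
    ∃ a : ℚ, 0 < a ∧ clsQ K a = g ∧ ∀ q : ℕ, q.Prime → ¬ T q → Even (padicValRat q a) := by
  induction hg using Subgroup.closure_induction with
  | mem g hg =>
    obtain ⟨ℓ, hℓ, hT, rfl⟩ := hg
    refine ⟨ℓ, by exact_mod_cast hℓ.pos, rfl, fun q hq hqT => ?_⟩
    have := Fact.mk hq
    have := Fact.mk hℓ
    have hne : q ≠ ℓ := by rintro rfl; exact hqT hT
    rw [padicValRat.of_nat, padicValNat_primes hne]
    simp
  | one => exact ⟨1, one_pos, clsQ_one, by simp⟩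
  | mul g h _ _ ihg ihh =>
    obtain ⟨a, ha, rfl, ha'⟩ := ihg
    obtain ⟨b, hb, rfl, hb'⟩ := ihh
    refine ⟨a * b, mul_pos ha hb, clsQ_mul ha hb, fun q hq hqT => ?_⟩
    have := Fact.mk hq
    rw [padicValRat.mul ha.ne' hb.ne']
    exact (ha' q hq hqT).add (hb' q hq hqT)
  | inv g _ ih =>
    obtain ⟨a, ha, rfl, ha'⟩ := ih
    refine ⟨a⁻¹, inv_pos.mpr ha, ?_, fun q hq hqT => ?_⟩
    · rw [eq_inv_iff_mul_eq_one, ← clsQ_mul (inv_pos.mpr ha) ha, inv_mul_cancel₀ ha.ne', clsQ_one]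
    · have := Fact.mk hq
      rw [padicValRat.inv]
      exact (ha' q hq hqT).neg

variable [FiniteDimensional ℚ K]

/-- The valuations at inert primes of representatives of the same class have the same parity. -/
lemma even_padicValRat_of_clsQ_eq (hK2 : Module.finrank ℚ K = 2) {a b : ℚ} (ha : 0 < a)
    (hb : 0 < b) (hab : clsQ K a = clsQ K b) {ℓ : ℕ} (hℓ : ℓ.Prime) (hI : IsInert K ℓ)
    (h : Even (padicValRat ℓ b)) : Even (padicValRat ℓ a) := by
  have := Fact.mk hℓ
  have h1 : clsQ K (a * b) = 1 := by rw [clsQ_mul ha hb, hab, QmodN.mul_self hK2]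
  obtain ⟨x, hx, hxab⟩ := (clsQ_eq_one_iff (mul_pos ha hb)).mp h1
  have h2 := even_padicValRat_norm hK2 hℓ hI hx
  rw [← hxab, padicValRat.mul ha.ne' hb.ne'] at h2
  exact (Int.even_add.mp h2).mpr h

end NormClasses

lemma padicValNat_eq_one_of_squarefree {n q : ℕ} (hn : Squarefree n) (hq : q.Prime)
    (hd : q ∣ n) : padicValNat q n = 1 := by
  have := Fact.mk hq
  have h1 := one_le_padicValNat_of_dvd hn.ne_zero hd
  have h2 := hn.natFactorization_le_one q
  rw [Nat.factorization_def n hq] at h2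
  omega

lemma exists_eq_sq_of_even_padicValRat {a : ℚ} (ha : 0 < a)
    (h : ∀ q : ℕ, q.Prime → Even (padicValRat q a)) : ∃ r : ℚ, 0 < r ∧ a = r ^ 2 := by
  obtain ⟨n, m, hnm, hsq⟩ := Nat.sq_mul_squarefree (a.num.toNat * a.den)
  have hnum : 0 < a.num := Rat.num_pos.mpr ha
  have hden : (a.den : ℚ) ≠ 0 := by exact_mod_cast a.den_nz
  have hcast : ((a.num.toNat : ℕ) : ℚ) = a.num := by
    exact_mod_cast congrArg (Int.cast : ℤ → ℚ) (Int.toNat_of_nonneg hnum.le)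
  have hm0 : m ≠ 0 := by
    rintro rfl
    have : 0 < a.num.toNat * a.den := Nat.mul_pos (by omega) a.den_pos
    rw [← hnm] at this
    simp at this
  have hm : (m : ℚ) ≠ 0 := by exact_mod_cast hm0
  have hn : (n : ℚ) ≠ 0 := by exact_mod_cast hsq.ne_zero
  have hnm' : (m : ℚ) ^ 2 * n = a.num * a.den := by
    rw [← hcast]; exact_mod_cast hnm
  have key : a = (m / a.den : ℚ) ^ 2 * n := by
    rw [div_pow, div_mul_eq_mul_div, hnm', sq, mul_div_mul_right _ _ hden, Rat.num_div_den]
  have hn1 : n = 1 := by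
    by_contra hne
    obtain ⟨q, hq, hqn⟩ := Nat.exists_prime_and_dvd hne
    have := Fact.mk hq
    have hev := h q hq
    rw [key, padicValRat.mul (pow_ne_zero 2 (div_ne_zero hm hden)) hn,
      padicValRat.pow, padicValRat.of_nat,
      padicValNat_eq_one_of_squarefree hsq hq hqn] at hev
    have h1 := (Int.even_add.mp hev).mp (by simp)
    norm_num at h1
  refine ⟨m / a.den, by positivity, ?_⟩
  rw [hn1] at key
  simpa using key

section Decomposition

variable {K : Type} [Field K] [Algebra ℚ K] [FiniteDimensional ℚ K]

lemma GammaIn_sup_GammaRs (hK2 : Module.finrank ℚ K = 2) : GammaIn K ⊔ GammaRs K = ⊤ := by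
  have hnat : ∀ n : ℕ, 0 < n → clsQ K (n : ℚ) ∈ GammaIn K ⊔ GammaRs K := by
    intro n
    induction n using induction_on_primes with
    | zero => simp
    | one => simp [clsQ_one, one_mem]
    | prime_mul ℓ a hℓ ih =>
      intro hpos
      have ha : 0 < a := Nat.pos_of_mul_pos_left hpos
      rw [Nat.cast_mul, clsQ_mul (by exact_mod_cast hℓ.pos) (by exact_mod_cast ha)]
      refine mul_mem ?_ (ih ha)
      by_cases hI : IsInert K ℓ
      · exact Subgroup.mem_sup_left (Subgroup.subset_closure ⟨ℓ, hℓ, hI, rfl⟩)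
      · exact Subgroup.mem_sup_right (Subgroup.subset_closure
          ⟨ℓ, hℓ, isSplit_or_isRamified_of_not_isInert hK2 hℓ hI, rfl⟩)
  refine eq_top_iff.mpr fun g _ => ?_
  obtain ⟨a, ha, rfl⟩ := exists_clsQ_eq g
  have hnum : 0 < a.num := Rat.num_pos.mpr ha
  have hden : (0 : ℚ) < a.den := by exact_mod_cast a.den_pos
  have h : clsQ K (a * a.den) ∈ GammaIn K ⊔ GammaRs K := by
    have hcast : a * a.den = ((a.num.toNat : ℕ) : ℚ) := by
      rw [Rat.mul_den_eq_num]
      exact_mod_cast congrArg (Int.cast : ℤ → ℚ) (Int.toNat_of_nonneg hnum.le).symm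
    rw [hcast]
    exact hnat _ (by omega)
  rw [clsQ_mul ha hden] at h
  exact (Subgroup.mul_mem_cancel_right _ (hnat _ a.den_pos)).mp h

lemma GammaIn_inf_GammaRs (hK2 : Module.finrank ℚ K = 2) : GammaIn K ⊓ GammaRs K = ⊥ := by
  refine eq_bot_iff.mpr fun g hg => ?_
  obtain ⟨hin, hrs⟩ := Subgroup.mem_inf.mp hg
  obtain ⟨a, ha, rfl, hae⟩ := exists_clsQ_eq_of_mem_closure _ hin
  obtain ⟨b, hb, hab, hbe⟩ := exists_clsQ_eq_of_mem_closure _ hrs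
  obtain ⟨r, hr, rfl⟩ := exists_eq_sq_of_even_padicValRat ha fun q hq => by
    by_cases hI : IsInert K q
    · exact even_padicValRat_of_clsQ_eq hK2 ha hb hab.symm hq hI
        (hbe q hq fun h => not_isInert_of_isSplit_or_isRamified hq h hI)
    · exact hae q hq hI
  exact Subgroup.mem_bot.mpr (clsQ_sq hK2 hr)

lemma not_exists_norm_eq_of_squarefree (hK2 : Module.finrank ℚ K = 2) {a ℓ : ℕ}
    (ha : Squarefree a) (hℓ : ℓ.Prime) (hI : IsInert K ℓ) (hd : ℓ ∣ a) :
    ¬ ∃ x : K, x ≠ 0 ∧ (a : ℚ) = Algebra.norm ℚ x := by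
  rintro ⟨x, hx, h⟩
  have hev := even_padicValRat_norm hK2 hℓ hI hx
  rw [← h, padicValRat.of_nat, padicValNat_eq_one_of_squarefree ha hℓ hd] at hev
  norm_num at hev

end Decomposition

theorem stmt4
    (p : ℕ) (hp : p.Prime)
    (K : Type) [Field K] [Algebra ℚ K] [FiniteDimensional ℚ K]
    (hK2 : Module.finrank ℚ K = 2)
    (sp : K) (hsp : sp ^ 2 = -(p : K)) :
    -- ℚ₊ˣ/N(Kˣ) is an elementary abelian 2-group,
    (∀ g : QmodN K, g * g = 1) ∧
    -- it is the internal direct product of Γ_in and Γ_rs,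
    (GammaIn K ⊔ GammaRs K = ⊤) ∧ (GammaIn K ⊓ GammaRs K = ⊥) ∧
    -- the classes of the inert primes are 𝔽₂-independent (hence an 𝔽₂-basis of Γ_in,
    -- which they generate by definition),
    (∀ S : Finset ℕ, (∀ ℓ ∈ S, ℓ.Prime ∧ IsInert K ℓ) →
        (∏ ℓ ∈ S, clsQ K (ℓ : ℚ)) = 1 → S = ∅) ∧
    -- in particular: a square-free positive integer divisible by an inert prime is not
    -- a norm from Kˣ.
    (∀ a : ℕ, 0 < a → Squarefree a → (∃ ℓ : ℕ, ℓ.Prime ∧ IsInert K ℓ ∧ ℓ ∣ a) →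
        ¬ ∃ x : K, x ≠ 0 ∧ (a : ℚ) = Algebra.norm ℚ x) := by
  refine ⟨QmodN.mul_self hK2, GammaIn_sup_GammaRs hK2, GammaIn_inf_GammaRs hK2, ?_, ?_⟩
  · intro S hS hprod
    by_contra hne
    obtain ⟨ℓ, hℓ⟩ := Finset.nonempty_iff_ne_empty.mpr hne
    have hpos : ∀ q ∈ S, 0 < q := fun q hq => (hS q hq).1.pos
    have hsq : Squarefree (∏ q ∈ S, q) :=
      Finset.squarefree_prod_of_pairwise_isCoprime
        (fun q hq r hr hqr => Nat.coprime_iff_isRelPrime.mp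
          ((Nat.coprime_primes (hS q hq).1 (hS r hr).1).mpr hqr))
        (fun q hq => (hS q hq).1.squarefree)
    rw [clsQ_prod hpos,
      clsQ_eq_one_iff (by exact_mod_cast Finset.prod_pos hpos)] at hprod
    exact not_exists_norm_eq_of_squarefree hK2 hsq (hS ℓ hℓ).1 (hS ℓ hℓ).2
      (Finset.dvd_prod_of_mem _ hℓ) hprod
  · rintro a - ha ⟨ℓ, hℓ, hI, hd⟩
    exact not_exists_norm_eq_of_squarefree hK2 ha hℓ hI hd
end

section
/- If p = 2 or p ≡ 3 (mod 4), then the subgroup Γ_rs of ℚ₊×/N(K×) generated by the classes of the primes split or ramified in K = ℚ(√−p) is trivial; equivalently, every positive rational number that is a product of primes split or ramified in K (with integer exponents) is a norm from K×. -/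
/-!
STATEMENT 5.  Let `K = ℚ(√-p)` with `p = 2` or `p ≡ 3 (mod 4)`.  Then the subgroup
`Γ_rs` of `ℚ₊ˣ/N(Kˣ)` generated by the classes of the primes split or ramified in `K`
is trivial; equivalently, every positive rational number that is a product of primes
split or ramified in `K` (with integer exponents, i.e. every element of the subgroup of
`ℚˣ` generated by those primes) is a norm from `Kˣ`.
-/

section Grp

variable (K : Type) [Field K] [Algebra ℚ K] [FiniteDimensional ℚ K]

/-- The subgroup of `ℚˣ` generated by the primes split or ramified in `K`. -/
def splitRamSubgroup : Subgroup ℚˣ :=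
  Subgroup.closure
    {u : ℚˣ | ∃ ℓ : ℕ, ℓ.Prime ∧ (IsSplit K ℓ ∨ IsRamified K ℓ) ∧ (u : ℚ) = (ℓ : ℚ)}

end Grp

/-- The pigeonhole argument of Thue for the ternary form `x² + p y² - l z²`. -/
theorem exists_small_isotropic_mod {p l : ℕ} (hp : p.Prime) (hl : l.Prime) (hne : l ≠ p)
    (r : ZMod l) (hr : r ^ 2 = -(p : ZMod l)) (s : ZMod p) (hs : s ^ 2 = (l : ZMod p)) :
    ∃ x y z : ℤ, (x ≠ 0 ∨ y ≠ 0 ∨ z ≠ 0) ∧ x ^ 2 ≤ p * l ∧ y ^ 2 < l ∧ z ^ 2 < p ∧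
      ((l * p : ℕ) : ℤ) ∣ x ^ 2 + p * y ^ 2 - l * z ^ 2 := by
  have : NeZero p := ⟨hp.ne_zero⟩
  have : NeZero l := ⟨hl.ne_zero⟩
  set A := Nat.sqrt (p * l) with hA
  set B := Nat.sqrt l with hB
  set C := Nat.sqrt p with hC
  let S := Finset.range (A + 1) ×ˢ (Finset.range (B + 1) ×ˢ Finset.range (C + 1))
  let f : ℕ × ℕ × ℕ → ZMod l × ZMod p := fun t => (t.1 - r * t.2.1, t.1 - s * t.2.2)
  have hcard : (Finset.univ : Finset (ZMod l × ZMod p)).card < S.card := by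
    simp only [S, Finset.card_product, Finset.card_range, Finset.card_univ, Fintype.card_prod,
      ZMod.card]
    have h1 : p * l < (A + 1) * (A + 1) := Nat.lt_succ_sqrt _
    have h2 : l < (B + 1) * (B + 1) := Nat.lt_succ_sqrt _
    have h3 : p < (C + 1) * (C + 1) := Nat.lt_succ_sqrt _
    refine lt_of_pow_lt_pow_left₀ 2 (Nat.zero_le _) ?_
    calc (l * p) ^ 2 = (p * l) * (l * p) := by ring
      _ < ((A + 1) * (A + 1)) * (((B + 1) * (B + 1)) * ((C + 1) * (C + 1))) :=
        Nat.mul_lt_mul'' h1 (Nat.mul_lt_mul'' h2 h3)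
      _ = _ := by ring
  obtain ⟨⟨x₁, y₁, z₁⟩, h₁, ⟨x₂, y₂, z₂⟩, h₂, hneq, heq⟩ :=
    Finset.exists_ne_map_eq_of_card_lt_of_maps_to hcard (f := f) fun _ _ => Finset.mem_univ _
  simp only [S, Finset.mem_product, Finset.mem_range, Nat.lt_succ_iff] at h₁ h₂
  simp only [f, Prod.mk.injEq] at heq
  have hdiff : ∀ {a b M : ℕ}, a ≤ M → b ≤ M → ((a : ℤ) - b) ^ 2 ≤ (M : ℤ) * M := by
    intro a b M ha hb
    rw [← sq, sq_le_sq, Nat.abs_cast, abs_le]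
    lia
  have hsqrt : ∀ n : ℕ, (Nat.sqrt n : ℤ) * Nat.sqrt n ≤ n := fun n => by
    exact_mod_cast Nat.sqrt_le n
  have hlt : ∀ {q : ℕ} {a : ℤ}, q.Prime → a ^ 2 ≤ q → a ^ 2 < q := by
    intro q a hq h
    refine lt_of_le_of_ne h fun h' => ?_
    exact (Nat.prime_iff_prime_int.mp hq).irreducible.not_isSquare ⟨a, by rw [← h', sq]⟩
  refine ⟨x₁ - x₂, y₁ - y₂, z₁ - z₂, ?_, ?_, ?_, ?_, ?_⟩
  · by_contra! h
    apply hneq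
    simp only [Prod.mk.injEq]
    lia
  · exact_mod_cast (hdiff h₁.1 h₂.1).trans (hsqrt _)
  · exact hlt hl ((hdiff h₁.2.1 h₂.2.1).trans (hsqrt _))
  · exact hlt hp ((hdiff h₁.2.2 h₂.2.2).trans (hsqrt _))
  · push_cast
    refine IsCoprime.mul_dvd ?_ ?_ ?_
    · exact Nat.isCoprime_iff_coprime.mpr ((Nat.coprime_primes hl hp).mpr hne)
    · rw [← ZMod.intCast_zmod_eq_zero_iff_dvd]
      push_cast
      rw [ZMod.natCast_self]
      linear_combination (x₁ - x₂ + r * (y₁ - y₂) : ZMod l) * heq.1 + (y₁ - y₂ : ZMod l) ^ 2 * hr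
    · rw [← ZMod.intCast_zmod_eq_zero_iff_dvd]
      push_cast
      rw [ZMod.natCast_self]
      linear_combination (x₁ - x₂ + s * (z₁ - z₂) : ZMod p) * heq.2 + (z₁ - z₂ : ZMod p) ^ 2 * hs

/-- A prime `l` that is a square modulo `p`, and modulo which `-p` is a square, is represented
by `a² + p b²` over `ℚ`. -/
theorem exists_rat_eq_sq_add_mul_sq {p l : ℕ} (hp : p.Prime) (hl : l.Prime) (hne : l ≠ p)
    (h₁ : IsSquare (-(p : ZMod l))) (h₂ : IsSquare (l : ZMod p)) :
    ∃ a b : ℚ, (l : ℚ) = a ^ 2 + p * b ^ 2 := by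
  obtain ⟨r, hr⟩ := h₁
  obtain ⟨s, hs⟩ := h₂
  obtain ⟨x, y, z, h0, hx, hy, hz, k, hk⟩ :=
    exists_small_isotropic_mod hp hl hne r (by rw [hr, sq]) s (by rw [hs, sq])
  push_cast at hk
  have hp0 : (0 : ℤ) < p := by exact_mod_cast hp.pos
  have hl0 : (0 : ℤ) < l := by exact_mod_cast hl.pos
  have hlp : (0 : ℤ) < l * p := mul_pos hl0 hp0
  have hpy : (p : ℤ) * y ^ 2 < p * l := mul_lt_mul_of_pos_left hy hp0
  have hlz : (l : ℤ) * z ^ 2 < l * p := mul_lt_mul_of_pos_left hz hl0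
  have hpy0 : 0 ≤ (p : ℤ) * y ^ 2 := by positivity
  have hlz0 : 0 ≤ (l : ℤ) * z ^ 2 := by positivity
  have hk0 : 0 ≤ k := by
    by_contra! h
    nlinarith [sq_nonneg x]
  have hk2 : k < 2 := by
    by_contra! h
    nlinarith
  interval_cases k
  · have hz0 : z ≠ 0 := by
      rintro rfl
      have hx0 : x ^ 2 = 0 := by nlinarith [sq_nonneg x]
      have hy0 : (p : ℤ) * y ^ 2 = 0 := by nlinarith [sq_nonneg x]
      simp_all
    have hzq : (z : ℚ) ≠ 0 := by exact_mod_cast hz0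
    refine ⟨x / z, y / z, ?_⟩
    have hkq : (x : ℚ) ^ 2 + p * y ^ 2 - l * z ^ 2 = 0 := by exact_mod_cast hk.trans (mul_zero _)
    field_simp
    linear_combination -hkq
  · have hkq : (x : ℚ) ^ 2 + p * y ^ 2 - l * z ^ 2 = l * p := by
      exact_mod_cast hk.trans (mul_one _)
    have hpq : (0 : ℚ) < p := by exact_mod_cast hp.pos
    have hd : (z : ℚ) ^ 2 + p ≠ 0 := by positivity
    refine ⟨(x * z + p * y) / (z ^ 2 + p), (y * z - x) / (z ^ 2 + p), ?_⟩
    field_simp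
    linear_combination -(z ^ 2 + p : ℚ) * hkq

/-- The norm form of `ℚ(√-p)`. -/
theorem norm_add_mul_sqrt {p : ℕ} (hp : p.Prime) {K : Type*} [Field K] [Algebra ℚ K]
    (hK : Module.finrank ℚ K = 2) {sp : K} (hsp : sp ^ 2 = -(p : K)) (a b : ℚ) :
    Algebra.norm ℚ (algebraMap ℚ K a + algebraMap ℚ K b * sp) = a ^ 2 + p * b ^ 2 := by
  have hpq : (0 : ℚ) < p := by exact_mod_cast hp.pos
  have hsp' : ∀ c : ℚ, algebraMap ℚ K c ≠ sp := by
    rintro c rfl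
    have h : algebraMap ℚ K (c ^ 2) = algebraMap ℚ K (-(p : ℚ)) := by simpa using hsp
    have h' := (algebraMap ℚ K).injective h
    nlinarith [sq_nonneg c]
  have hli : LinearIndependent ℚ ![(1 : K), sp] := by
    rw [LinearIndependent.pair_iff]
    intro c d h
    rw [Algebra.smul_def, Algebra.smul_def, mul_one] at h
    have hd : d = 0 := by
      by_contra hd
      have hdK : algebraMap ℚ K d ≠ 0 := (map_ne_zero _).mpr hd
      apply hsp' (-c / d)
      rw [map_div₀, map_neg]
      field_simp
      linear_combination -h
    rw [hd, map_zero, zero_mul, add_zero, map_eq_zero] at h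
    exact ⟨h, hd⟩
  let B := basisOfLinearIndependentOfCardEqFinrank hli (by simp [hK])
  have hB0 : B 0 = 1 := by simp [B]
  have hB1 : B 1 = sp := by simp [B]
  have key : LinearMap.mul ℚ K (algebraMap ℚ K a + algebraMap ℚ K b * sp) =
      Matrix.toLin B B !![a, -(p * b); b, a] := by
    refine B.ext fun i => ?_
    rw [Matrix.toLin_self]
    fin_cases i
    · simp [hB0, hB1, Algebra.smul_def]
    · simp [hB0, hB1, Algebra.smul_def, -eq_ratCast]
      linear_combination algebraMap ℚ K b * hsp
  rw [Algebra.norm_apply]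
  change LinearMap.det (LinearMap.mul ℚ K _) = _
  rw [key, LinearMap.det_toLin, Matrix.det_fin_two_of]
  ring

/-- In a quadratic field, a prime `l` whose ideal is a product of two prime ideals admits a
residue field `𝔽_l`. -/
theorem nonempty_ringHom_zmod {K : Type} [Field K] [Algebra ℚ K] [FiniteDimensional ℚ K]
    (hK : Module.finrank ℚ K = 2) {l : ℕ} (hl : l.Prime) {P Q : Ideal (OK K)} (hP : P.IsPrime)
    (hQ : Q.IsPrime) (h : Ideal.span {(l : OK K)} = P * Q) : Nonempty (OK K →+* ZMod l) := by
  have : CharZero K := algebraRat.charZero K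
  have : IsDedekindDomain (OK K) := IsIntegralClosure.isDedekindDomain ℤ ℚ K (OK K)
  have : Module.Free ℤ (OK K) := IsIntegralClosure.module_free ℤ ℚ K (OK K)
  have : IsNoetherian ℤ (OK K) := IsIntegralClosure.isNoetherian ℤ ℚ K (OK K)
  have hrank : Module.finrank ℤ (OK K) = 2 := by
    rw [IsIntegralClosure.rank ℤ ℚ K (OK K), hK]
  have hN : P.absNorm * Q.absNorm = l ^ 2 := by
    rw [← map_mul, ← h, Ideal.absNorm_span_natCast, hrank]
  have hP1 : P.absNorm ≠ 1 := fun h => hP.ne_top (Ideal.absNorm_eq_one_iff.mp h)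
  have hQ1 : Q.absNorm ≠ 1 := fun h => hQ.ne_top (Ideal.absNorm_eq_one_iff.mp h)
  have hPl : P.absNorm = l := ((hl.mul_eq_prime_sq_iff hP1 hQ1).mp hN).1
  have hcard : Nat.card (OK K ⧸ P) = l := hPl
  have : Finite (OK K ⧸ P) := Nat.finite_of_card_ne_zero (hcard ▸ hl.ne_zero)
  have := Fintype.ofFinite (OK K ⧸ P)
  let e := ZMod.ringEquivOfPrime (OK K ⧸ P) hl (by rw [← hcard, Nat.card_eq_fintype_card])
  exact ⟨e.symm.toRingHom.comp (Ideal.Quotient.mk P)⟩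

/-- `-p` is a square modulo every `l` that admits a ring homomorphism `O_K → 𝔽_l`. -/
theorem isSquare_neg_of_ringHom {K : Type} [Field K] {p l : ℕ} {sp : K}
    (hsp : sp ^ 2 = -(p : K)) (φ : OK K →+* ZMod l) : IsSquare (-(p : ZMod l)) := by
  have hInt : IsIntegral ℤ sp := by
    refine IsIntegral.of_pow two_pos ?_
    rw [hsp]
    simpa using (isIntegral_algebraMap (R := ℤ) (A := K) (x := (p : ℤ))).neg
  let t : OK K := ⟨sp, hInt⟩
  have ht : t * t = -(p : OK K) := Subtype.ext (by simpa [t, sq] using hsp)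
  exact ⟨φ t, by rw [← map_mul, ht, map_neg, map_natCast]⟩

/-- If `O_K` has a residue field `𝔽₂` and `p ≡ 3 (mod 4)` then `p ≡ 7 (mod 8)`. -/
theorem mod_eight_of_ringHom {K : Type} [Field K] [CharZero K] {p : ℕ} {sp : K}
    (hsp : sp ^ 2 = -(p : K)) (hp4 : p % 4 = 3) (φ : OK K →+* ZMod 2) : p % 8 = 7 := by
  obtain ⟨m, hm⟩ : ∃ m : ℕ, p + 1 = 4 * m := ⟨(p + 1) / 4, by lia⟩
  have hmK : (p : K) + 1 = 4 * m := by exact_mod_cast hm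
  have hroot : ((1 + sp) / 2) ^ 2 - (1 + sp) / 2 + (m : K) = 0 := by
    linear_combination hsp / 4 - hmK / 4
  have hInt : IsIntegral ℤ ((1 + sp) / 2) := by
    refine ⟨Polynomial.X ^ 2 - Polynomial.X + Polynomial.C (m : ℤ), by monicity!, ?_⟩
    simpa using hroot
  let t : OK K := ⟨(1 + sp) / 2, hInt⟩
  have ht : t ^ 2 - t + (m : OK K) = 0 := Subtype.ext (by simpa [t] using hroot)
  have hφ := congrArg φ ht
  rw [map_add, map_sub, map_pow, map_natCast, map_zero] at hφ
  have hz : ∀ u : ZMod 2, u ^ 2 - u = 0 := by decide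
  rw [hz, zero_add, ZMod.natCast_eq_zero_iff] at hφ
  lia

/-- For `p ≡ 3 (mod 4)` and odd `l`, if `-p` is a square modulo `l` then `l` is a square
modulo `p`. -/
theorem isSquare_of_isSquare_neg {p l : ℕ} (hp : p.Prime) (hl : l.Prime) (hne : l ≠ p)
    (hp4 : p % 4 = 3) (hl2 : l ≠ 2) (h : IsSquare (-(p : ZMod l))) : IsSquare (l : ZMod p) := by
  have : Fact p.Prime := ⟨hp⟩
  have : Fact l.Prime := ⟨hl⟩
  have hp2 : p ≠ 2 := by lia
  have hl' : l % 4 = 1 ∨ l % 4 = 3 := by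
    have := hl.eq_two_or_odd
    lia
  rcases hl' with hl4 | hl4
  · have h1 : IsSquare (-1 : ZMod l) := ZMod.exists_sq_eq_neg_one_iff.mpr (by lia)
    rw [← ZMod.exists_sq_eq_prime_iff_of_mod_four_eq_one hl4 hp2]
    simpa using h1.mul h
  · rw [ZMod.exists_sq_eq_prime_iff_of_mod_four_eq_three hp4 hl4 hne.symm]
    intro h'
    have hp0 : (p : ZMod l) ≠ 0 := ZMod.prime_ne_zero l p hne
    have h1 : IsSquare (-1 : ZMod l) := by
      have := h.div h'
      rwa [neg_div, div_self hp0] at this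
    exact ZMod.exists_sq_eq_neg_one_iff.mp h1 hl4

/-- Every prime split or ramified in `ℚ(√-p)` is a norm. -/
theorem exists_norm_eq_of_split_or_ramified {p : ℕ} (hp : p.Prime) (hcase : p = 2 ∨ p % 4 = 3)
    {K : Type} [Field K] [Algebra ℚ K] [FiniteDimensional ℚ K] (hK2 : Module.finrank ℚ K = 2)
    {sp : K} (hsp : sp ^ 2 = -(p : K)) {l : ℕ} (hl : l.Prime)
    (h : IsSplit K l ∨ IsRamified K l) : ∃ x : K, x ≠ 0 ∧ (l : ℚ) = Algebra.norm ℚ x := by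
  suffices ∃ a b : ℚ, (l : ℚ) = a ^ 2 + p * b ^ 2 by
    obtain ⟨a, b, hab⟩ := this
    rw [← norm_add_mul_sqrt hp hK2 hsp] at hab
    refine ⟨_, fun h0 => ?_, hab⟩
    rw [h0, Algebra.norm_zero] at hab
    exact hl.ne_zero (by exact_mod_cast hab)
  rcases eq_or_ne l p with rfl | hne
  · exact ⟨0, 1, by simp⟩
  have : CharZero K := algebraRat.charZero K
  obtain ⟨φ⟩ : Nonempty (OK K →+* ZMod l) := by
    rcases h with ⟨P, Q, hP, hQ, -, h⟩ | ⟨P, hP, h⟩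
    · exact nonempty_ringHom_zmod hK2 hl hP hQ h
    · exact nonempty_ringHom_zmod hK2 hl hP hP (h.trans (sq P))
  have hsq := isSquare_neg_of_ringHom hsp φ
  refine exists_rat_eq_sq_add_mul_sq hp hl hne hsq ?_
  rcases hcase with rfl | hp4
  · generalize (l : ZMod 2) = u
    exact ⟨u, by revert u; decide⟩
  rcases eq_or_ne l 2 with rfl | hl2
  · have : Fact p.Prime := ⟨hp⟩
    rw [Nat.cast_ofNat, ZMod.exists_sq_eq_two_iff (by lia)]
    exact .inr (mod_eight_of_ringHom hsp hp4 φ)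
  · exact isSquare_of_isSquare_neg hp hl hne hp4 hl2 hsq

theorem stmt5
    (p : ℕ) (hp : p.Prime) (hcase : p = 2 ∨ p % 4 = 3)
    (K : Type) [Field K] [Algebra ℚ K] [FiniteDimensional ℚ K]
    (hK2 : Module.finrank ℚ K = 2)
    (sp : K) (hsp : sp ^ 2 = -(p : K)) :
    -- Γ_rs is trivial;
    GammaRs K = ⊥ ∧
    -- equivalently, every positive rational which is a product of split or ramified
    -- primes (with integer exponents) is a norm from Kˣ.
    (∀ u : ℚˣ, u ∈ splitRamSubgroup K →
        ∃ x : K, x ≠ 0 ∧ (u : ℚ) = Algebra.norm ℚ x) := by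
  constructor
  · rw [GammaRs, Subgroup.closure_eq_bot_iff]
    rintro g ⟨l, hl, hsr, rfl⟩
    obtain ⟨x, hx0, hx⟩ := exists_norm_eq_of_split_or_ramified hp hcase hK2 hsp hl hsr
    have hl0 : (0 : ℚ) < l := by exact_mod_cast hl.pos
    rw [Set.mem_singleton_iff, clsQ]
    refine (dif_pos hl0).trans ((QuotientGroup.eq_one_iff (N := normSubgroup K) _).mpr ?_)
    exact ⟨Units.mk0 x hx0, Units.ext hx.symm⟩
  · suffices h : splitRamSubgroup K ≤ (Units.map (Algebra.norm ℚ : K →* ℚ)).range by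
      intro u hu
      obtain ⟨x, rfl⟩ := h hu
      exact ⟨x, x.ne_zero, rfl⟩
    rw [splitRamSubgroup, Subgroup.closure_le]
    rintro u ⟨l, hl, hsr, hu⟩
    obtain ⟨x, hx0, hx⟩ := exists_norm_eq_of_split_or_ramified hp hcase hK2 hsp hl hsr
    exact ⟨Units.mk0 x hx0, Units.ext (hx.symm.trans hu.symm)⟩
end

section
/- Every √−p-modular hermitian O_{K_p}-lattice has even rank, where K_p = ℚ_p(√−p) is the completion of K = ℚ(√−p) at the ramified prime p. -/
open Module

namespace RamifiedHermitian

variable {p : ℕ} [hp : Fact p.Prime]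

theorem padic_norm_sq_ne (a b : ℚ_[p]) (ha : a ≠ 0) : ‖a ^ 2‖ ≠ ‖(p : ℚ_[p]) * b ^ 2‖ := by
  have hp1 : (1 : ℝ) < p := by exact_mod_cast hp.out.one_lt
  by_cases hb : b = 0
  · simp [hb, ha]
  intro h
  rw [norm_mul, norm_pow, norm_pow, Padic.norm_p, Padic.norm_eq_zpow_neg_valuation ha,
    Padic.norm_eq_zpow_neg_valuation hb, ← zpow_natCast, ← zpow_natCast, ← zpow_mul, ← zpow_mul,
    ← zpow_neg_one, ← zpow_add₀ (by positivity)] at h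
  have := zpow_right_injective₀ (by positivity) hp1.ne' h
  push_cast at this
  omega

theorem padic_norm_le_one_of_norm_form_le_one (a b : ℚ_[p]) (h : ‖a ^ 2 + p * b ^ 2‖ ≤ 1) :
    ‖a‖ ≤ 1 ∧ ‖b‖ ≤ 1 := by
  have hp1 : (1 : ℝ) < p := by exact_mod_cast hp.out.one_lt
  have key : ‖a ^ 2‖ ≤ 1 ∧ ‖(p : ℚ_[p]) * b ^ 2‖ ≤ 1 := by
    by_cases ha : a = 0
    · subst ha
      simpa using h
    · rw [Padic.add_eq_max_of_ne (padic_norm_sq_ne a b ha)] at h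
      exact max_le_iff.mp h
  obtain ⟨h1, h2⟩ := key
  refine ⟨by rwa [norm_pow, sq_le_one_iff₀ (norm_nonneg _)] at h1, ?_⟩
  by_cases hb : b = 0
  · simp [hb]
  rw [norm_mul, norm_pow, Padic.norm_p, Padic.norm_eq_zpow_neg_valuation hb, ← zpow_natCast,
    ← zpow_mul, ← zpow_neg_one, ← zpow_add₀ (by positivity),
    zpow_le_one_iff_right₀ hp1] at h2
  rw [Padic.norm_eq_zpow_neg_valuation hb, zpow_le_one_iff_right₀ hp1]
  push_cast at h2
  omega

theorem sq_ne_neg_p (c : ℚ_[p]) : c ^ 2 ≠ -(p : ℚ_[p]) := by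
  intro h
  have hp0 : (p : ℚ_[p]) ≠ 0 := by exact_mod_cast hp.out.ne_zero
  have hc : c ≠ 0 := by
    rintro rfl
    apply hp0
    simpa using h.symm
  apply padic_norm_sq_ne c 1 hc
  rw [h, norm_neg, one_pow, mul_one]

variable {K : Type*} [Field K] [Algebra ℚ_[p] K]

theorem exists_eq_add_mul (hK2 : finrank ℚ_[p] K = 2) {sp : K} (hsp : sp ^ 2 = -(p : K)) (x : K) :
    ∃ a b : ℚ_[p], x = algebraMap ℚ_[p] K a + algebraMap ℚ_[p] K b * sp := by
  have hli : LinearIndependent ℚ_[p] ![(1 : K), sp] := by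
    rw [LinearIndependent.pair_iff' one_ne_zero]
    intro a ha
    rw [Algebra.smul_def, mul_one] at ha
    apply sq_ne_neg_p a
    apply (algebraMap ℚ_[p] K).injective
    rw [map_pow, ha, hsp]
    simp
  have : FiniteDimensional ℚ_[p] K := .of_finrank_pos (by omega)
  have hspan := hli.span_eq_top_of_card_eq_finrank' (by simp [hK2])
  have hx : x ∈ Submodule.span ℚ_[p] (Set.range ![(1 : K), sp]) := hspan ▸ Submodule.mem_top
  rw [Matrix.range_cons, Matrix.range_cons, Matrix.range_empty, Set.union_empty,
    Set.singleton_union, Submodule.mem_span_pair] at hx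
  obtain ⟨a, b, rfl⟩ := hx
  exact ⟨a, b, by simp [Algebra.smul_def]⟩

theorem mem_range_of_conj_fixed (hK2 : finrank ℚ_[p] K = 2) {sp : K} (hsp : sp ^ 2 = -(p : K))
    {σ : K →ₐ[ℚ_[p]] K} (hσ : σ sp = -sp) {x : K} (hx : σ x = x) :
    ∃ a : ℚ_[p], x = algebraMap ℚ_[p] K a := by
  have : CharZero K := charZero_of_injective_algebraMap (algebraMap ℚ_[p] K).injective
  obtain ⟨a, b, rfl⟩ := exists_eq_add_mul hK2 hsp x
  refine ⟨a, ?_⟩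
  rw [map_add, map_mul, AlgHom.commutes, AlgHom.commutes, hσ] at hx
  have h2 : (2 : K) * (algebraMap ℚ_[p] K b * sp) = 0 := by linear_combination -hx
  rw [(mul_eq_zero.mp h2).resolve_left two_ne_zero, add_zero]

variable [Algebra ℤ_[p] K] [IsScalarTower ℤ_[p] ℚ_[p] K]

theorem isIntegral_of_norm_form_le_one {sp : K} (hsp : sp ^ 2 = -(p : K)) {a b : ℚ_[p]}
    (h : ‖a ^ 2 + p * b ^ 2‖ ≤ 1) :
    IsIntegral ℤ_[p] (algebraMap ℚ_[p] K a + algebraMap ℚ_[p] K b * sp) := by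
  obtain ⟨ha, hb⟩ := padic_norm_le_one_of_norm_form_le_one a b h
  have hint : ∀ c : ℚ_[p], ‖c‖ ≤ 1 → IsIntegral ℤ_[p] (algebraMap ℚ_[p] K c) := fun c hc => by
    obtain ⟨y, rfl⟩ : ∃ y : ℤ_[p], algebraMap ℤ_[p] ℚ_[p] y = c := ⟨⟨c, hc⟩, rfl⟩
    rw [← IsScalarTower.algebraMap_apply ℤ_[p] ℚ_[p] K]
    exact isIntegral_algebraMap
  have hspi : IsIntegral ℤ_[p] sp := by
    apply IsIntegral.of_pow two_pos
    rw [hsp]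
    simpa using (isIntegral_algebraMap (R := ℤ_[p]) (A := K) (x := (p : ℤ_[p]))).neg
  exact (hint a ha).add ((hint b hb).mul hspi)

theorem isIntegral_or_isIntegral_inv (hK2 : finrank ℚ_[p] K = 2) {sp : K}
    (hsp : sp ^ 2 = -(p : K)) (x : K) : IsIntegral ℤ_[p] x ∨ IsIntegral ℤ_[p] x⁻¹ := by
  obtain ⟨a, b, rfl⟩ := exists_eq_add_mul hK2 hsp x
  by_cases h : ‖a ^ 2 + p * b ^ 2‖ ≤ 1
  · exact .inl (isIntegral_of_norm_form_le_one hsp h)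
  right
  set N := a ^ 2 + p * b ^ 2 with hN
  have hN0 : N ≠ 0 := by
    intro h0
    simp [h0] at h
  have hprod : (algebraMap ℚ_[p] K a + algebraMap ℚ_[p] K b * sp) *
      (algebraMap ℚ_[p] K (a / N) + algebraMap ℚ_[p] K (-b / N) * sp) = 1 := by
    have hNK : algebraMap ℚ_[p] K N ≠ 0 := by simpa using hN0
    have hNe : algebraMap ℚ_[p] K N =
        algebraMap ℚ_[p] K a ^ 2 + p * algebraMap ℚ_[p] K b ^ 2 := by simp [hN]
    rw [map_div₀, map_div₀, map_neg]
    field_simp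
    rw [hNe]
    linear_combination (-algebraMap ℚ_[p] K b ^ 2) * hsp
  rw [inv_eq_of_mul_eq_one_right hprod]
  apply isIntegral_of_norm_form_le_one hsp
  have : (a / N) ^ 2 + p * (-b / N) ^ 2 = N⁻¹ := by
    field_simp
    rw [hN]
  rw [this, norm_inv]
  exact inv_le_one_of_one_le₀ (not_le.mp h).le

theorem isPrincipalIdealRing_integralClosure (hK2 : finrank ℚ_[p] K = 2) {sp : K}
    (hsp : sp ^ 2 = -(p : K)) : IsPrincipalIdealRing (integralClosure ℤ_[p] K) := by
  have : FiniteDimensional ℚ_[p] K := .of_finrank_pos (by omega)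
  have : IsFractionRing (integralClosure ℤ_[p] K) K :=
    integralClosure.isFractionRing_of_finite_extension ℚ_[p] K
  have : IsNoetherianRing (integralClosure ℤ_[p] K) :=
    IsIntegralClosure.isNoetherianRing ℤ_[p] ℚ_[p] K _
  have : ValuationRing (integralClosure ℤ_[p] K) := by
    rw [ValuationRing.iff_isInteger_or_isInteger _ K]
    intro x
    exact (isIntegral_or_isIntegral_inv hK2 hsp x).imp (fun h => ⟨⟨x, h⟩, rfl⟩)
      fun h => ⟨⟨x⁻¹, h⟩, rfl⟩
  infer_instance

theorem even_of_isIntegral_units {sp : K} (hsp : sp ^ 2 = -(p : K)) (n : ℕ) {d : ℚ_[p]}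
    (hd : d ≠ 0)
    (h1 : IsIntegral ℤ_[p] (sp⁻¹ ^ n * algebraMap ℚ_[p] K d))
    (h2 : IsIntegral ℤ_[p] (sp ^ n * (algebraMap ℚ_[p] K d)⁻¹)) : Even n := by
  have hp1 : (1 : ℝ) < p := by exact_mod_cast hp.out.one_lt
  have hint : ∀ c : ℚ_[p], IsIntegral ℤ_[p] (algebraMap ℚ_[p] K c) → ‖c‖ ≤ 1 := fun c hc => by
    rw [isIntegral_algebraMap_iff (algebraMap ℚ_[p] K).injective,
      IsIntegrallyClosed.isIntegral_iff] at hc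
    obtain ⟨y, rfl⟩ := hc
    exact y.2
  have e1 : (sp⁻¹ ^ n * algebraMap ℚ_[p] K d) ^ 2 =
      algebraMap ℚ_[p] K ((-(p : ℚ_[p]))⁻¹ ^ n * d ^ 2) := by
    rw [mul_pow, ← pow_mul, mul_comm n 2, pow_mul, inv_pow, hsp]
    simp
  have e2 : (sp ^ n * (algebraMap ℚ_[p] K d)⁻¹) ^ 2 =
      algebraMap ℚ_[p] K ((-(p : ℚ_[p])) ^ n * (d⁻¹) ^ 2) := by
    rw [mul_pow, ← pow_mul, mul_comm n 2, pow_mul, hsp]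
    simp
  have n1 := hint _ (e1 ▸ h1.pow 2)
  have n2 := hint _ (e2 ▸ h2.pow 2)
  simp only [norm_mul, norm_pow, norm_inv, norm_neg, Padic.norm_p, inv_inv,
    Padic.norm_eq_zpow_neg_valuation hd, ← zpow_neg, neg_neg] at n1 n2
  rw [← zpow_natCast, ← zpow_natCast, ← zpow_mul, ← zpow_add₀ (by positivity),
    zpow_le_one_iff_right₀ hp1] at n1
  rw [← zpow_neg_one, ← zpow_natCast, ← zpow_natCast, ← zpow_mul, ← zpow_mul,
    ← zpow_add₀ (by positivity), zpow_le_one_iff_right₀ hp1] at n2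
  push_cast at n1 n2
  rw [← Int.even_coe_nat]
  exact ⟨d.valuation, by omega⟩

/-- A finitely generated lattice stable under the integral closure admits a basis of the ambient
space for which the lattice consists of the vectors with integral coordinates. -/
theorem exists_basis_of_lattice (hK2 : finrank ℚ_[p] K = 2) {sp : K} (hsp : sp ^ 2 = -(p : K))
    {W : Type*} [AddCommGroup W] [Module ℤ_[p] W] [Module K W] [IsScalarTower ℤ_[p] K W]
    (M : Submodule ℤ_[p] W)
    (hstab : ∀ a : K, IsIntegral ℤ_[p] a → ∀ v ∈ M, a • v ∈ M)
    (hfg : M.FG) (hfull : Submodule.span K (M : Set W) = ⊤) :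
    ∃ (n : ℕ) (e : Basis (Fin n) K W), ∀ v, v ∈ M ↔ ∀ i, IsIntegral ℤ_[p] (e.repr v i) := by
  have : FiniteDimensional ℚ_[p] K := .of_finrank_pos (by omega)
  have := isPrincipalIdealRing_integralClosure hK2 hsp
  have : IsFractionRing (integralClosure ℤ_[p] K) K :=
    integralClosure.isFractionRing_of_finite_extension ℚ_[p] K
  have : IsTorsionFree (integralClosure ℤ_[p] K) W := .trans_faithfulSMul _ K _
  let L : Submodule (integralClosure ℤ_[p] K) W :=
    { M with smul_mem' := fun a v hv => hstab a a.2 v hv }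
  have hLfg : L.FG := by
    apply Submodule.FG.of_restrictScalars ℤ_[p]
    exact hfg
  have : Module.Finite (integralClosure ℤ_[p] K) L := Module.Finite.iff_fg.mpr hLfg
  obtain ⟨n, b⟩ := Module.basisOfFiniteTypeTorsionFree' (R := integralClosure ℤ_[p] K) (M := L)
  have hli : LinearIndependent K (fun i => (b i : W)) := by
    rw [← LinearIndependent.iff_fractionRing (integralClosure ℤ_[p] K) K]
    exact b.linearIndependent.map' L.subtype L.ker_subtype
  have hrepr : ∀ v : L, (v : W) = ∑ i, (b.repr v i : K) • (b i : W) := fun v => by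
    have := congrArg L.subtype (b.sum_repr v)
    rw [map_sum] at this
    exact this.symm
  have hsp' : ⊤ ≤ Submodule.span K (Set.range fun i => (b i : W)) := by
    rw [← hfull, Submodule.span_le]
    intro v hv
    rw [show v = _ from hrepr ⟨v, hv⟩]
    exact Submodule.sum_mem _ fun i _ => Submodule.smul_mem _ _ (Submodule.subset_span ⟨i, rfl⟩)
  refine ⟨n, Basis.mk hli hsp', fun v => ⟨fun hv i => ?_, fun h => ?_⟩⟩
  · have : v = ∑ i, (b.repr ⟨v, hv⟩ i : K) • Basis.mk hli hsp' i := by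
      simpa using hrepr ⟨v, hv⟩
    rw [this, Basis.repr_sum_self]
    exact (b.repr ⟨v, hv⟩ i).2
  · rw [← (Basis.mk hli hsp').sum_repr v]
    refine Submodule.sum_mem _ fun i _ => hstab _ (h i) _ ?_
    rw [Basis.mk_apply]
    exact (b i).2

end RamifiedHermitian

open RamifiedHermitian

open scoped Matrix

theorem stmt8
    (p : ℕ) [hp : Fact p.Prime]
    -- the ramified quadratic extension K_p = ℚ_p(√-p)
    (Kp : Type) [Field Kp] [Algebra ℚ_[p] Kp]
    [Algebra ℤ_[p] Kp] [IsScalarTower ℤ_[p] ℚ_[p] Kp]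
    (hK2 : Module.finrank ℚ_[p] Kp = 2)
    (sp : Kp) (hsp : sp ^ 2 = -(p : Kp))
    (σ : Kp →ₐ[ℚ_[p]] Kp) (hσ : σ sp = -sp)
    -- a nondegenerate hermitian K_p-space (W, ψ)
    (W : Type) [AddCommGroup W]
    [Module ℤ_[p] W] [Module ℚ_[p] W] [Module Kp W]
    [IsScalarTower ℤ_[p] Kp W] [IsScalarTower ℚ_[p] Kp W]
    [FiniteDimensional Kp W]
    (ψ : W →ₗ[ℚ_[p]] W →ₗ[ℚ_[p]] Kp)
    (hlin : ∀ (a : Kp) (x y : W), ψ (a • x) y = a * ψ x y)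
    (hherm : ∀ x y : W, ψ y x = σ (ψ x y))
    (hnd : ∀ x : W, (∀ y : W, ψ x y = 0) → x = 0)
    -- a √-p-modular O_{K_p}-lattice M in (W, ψ)
    (M : Submodule ℤ_[p] W)
    (hstab : ∀ a : Kp, IsIntegral ℤ_[p] a → ∀ v ∈ M, a • v ∈ M)
    (hfg : M.FG)
    (hfull : Submodule.span Kp (M : Set W) = ⊤)
    (hmod : ∀ v : W, v ∈ M ↔
      ∃ x : W, (∀ y ∈ M, IsIntegral ℤ_[p] (ψ x y)) ∧ v = sp • x) :
    Even (Module.finrank Kp W) := by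
  obtain ⟨n, e, he⟩ := exists_basis_of_lattice hK2 hsp M hstab hfg hfull
  rw [finrank_eq_card_basis e, Fintype.card_fin]
  have hp0 : (p : Kp) ≠ 0 := by
    have : CharZero Kp := charZero_of_injective_algebraMap (algebraMap ℚ_[p] Kp).injective
    exact_mod_cast hp.out.ne_zero
  have hsp0 : sp ≠ 0 := by
    rintro rfl
    apply hp0
    simpa using hsp.symm
  have hlin2 : ∀ (a : Kp) (x y : W), ψ x (a • y) = σ a * ψ x y := fun a x y => by
    rw [hherm (a • y) x, hlin, map_mul, ← hherm]
  have heM : ∀ i, e i ∈ M := fun i => by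
    rw [he]
    intro j
    rw [e.repr_self, Finsupp.single_apply]
    split_ifs
    exacts [isIntegral_one, isIntegral_zero]
  let G : Matrix (Fin n) (Fin n) Kp := Matrix.of fun i j => ψ (e i) (e j)
  have hcomb : ∀ (v : Fin n → Kp) (j : Fin n), ψ (∑ i, v i • e i) (e j) = (v ᵥ* G) j :=
    fun v j => by simp [Matrix.vecMul, dotProduct, G, hlin]
  have hGdet : G.det ≠ 0 := by
    intro h0
    obtain ⟨v, hv0, hv⟩ := Matrix.exists_vecMul_eq_zero_iff.mpr h0
    apply hv0
    have hx : ∑ i, v i • e i = 0 := by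
      apply hnd
      intro y
      rw [← e.sum_repr y, map_sum]
      refine Finset.sum_eq_zero fun j _ => ?_
      rw [hlin2, hcomb, hv, Pi.zero_apply, mul_zero]
    exact funext fun i => Fintype.linearIndependent_iff.mp e.linearIndependent v hx i
  have hσG : σ G.det = G.det := by
    rw [AlgHom.map_det, ← Matrix.det_transpose]
    congr 1
    ext i j
    exact (hherm _ _).symm
  obtain ⟨d, hd⟩ := mem_range_of_conj_fixed hK2 hsp hσ hσG
  have h1 : IsIntegral ℤ_[p] (sp⁻¹ • G).det := by
    refine IsIntegral.det fun i j => ?_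
    obtain ⟨x, hx, hex⟩ := (hmod (e i)).mp (heM i)
    have hentry : (sp⁻¹ • G) i j = ψ x (e j) := by
      simp [G, hex, hlin, hsp0]
    rw [hentry]
    exact hx (e j) (heM j)
  have h2 : IsIntegral ℤ_[p] (sp • G⁻¹).det := by
    refine IsIntegral.det fun i j => ?_
    have hmem : sp • ∑ k, G⁻¹ i k • e k ∈ M := by
      refine (hmod _).mpr ⟨_, fun y hy => ?_, rfl⟩
      rw [← e.sum_repr y, map_sum]
      refine IsIntegral.sum _ fun k _ => ?_
      have hdual : (G⁻¹ i ᵥ* G) k = (1 : Matrix (Fin n) (Fin n) Kp) i k := by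
        rw [← Matrix.nonsing_inv_mul G (isUnit_iff_ne_zero.mpr hGdet)]
        rfl
      rw [hlin2, hcomb, hdual, Matrix.one_apply]
      refine IsIntegral.mul (((he y).mp hy k).map (σ.restrictScalars ℤ_[p])) ?_
      split_ifs
      exacts [isIntegral_one, isIntegral_zero]
    have := (he _).mp hmem j
    rw [map_smul, Finsupp.smul_apply, Basis.repr_sum_self] at this
    exact this
  rw [Matrix.det_smul, Fintype.card_fin, hd] at h1
  rw [Matrix.det_smul, Fintype.card_fin, Matrix.det_nonsing_inv, Ring.inverse_eq_inv', hd] at h2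
  refine even_of_isIntegral_units hsp n ?_ h1 h2
  rintro rfl
  exact hGdet (by simpa using hd)
end
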